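/- arXiv:2602.06561 — 9 statements merged into one kernel-verified Lean document; each statement's English description precedes it below -/
import Mathlib

section
/- Let N ≥ 2 be an integer, let x be a real number, and let y be an integer not divisible by N. Set ζ = exp(2πi/N). Then Σ_{q=0}^{N−1} ζ^{yq} · b₁((x+q)/N) = ζ^{−y·⌊x⌋}/(ζ^y − 1), an equality of complex numbers. -/
/-- The periodic Bernoulli function `b_k(x) = B_k(x - ⌊x⌋)`. -/
noncomputable def periodicBernoulli (k : ℕ) (x : ℝ) : ℝ :=
  Polynomial.aeval (Int.fract x) (Polynomial.bernoulli k)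

theorem periodicBernoulli_one (x : ℝ) : periodicBernoulli 1 x = Int.fract x - 1 / 2 := by
  simp [periodicBernoulli, Polynomial.bernoulli_one]

/-- The sum of an `N`-periodic function over `N` consecutive integers does not depend on where
the block of integers starts. -/
theorem Function.Periodic.sum_range_int_add {M : Type*} [AddCommGroup M] {g : ℤ → M} {N : ℕ}
    (hg : Function.Periodic g (N : ℤ)) (m : ℤ) :
    ∑ q ∈ Finset.range N, g (m + q) = ∑ q ∈ Finset.range N, g q := by
  have step (k : ℤ) :
      ∑ q ∈ Finset.range N, g (k + 1 + q) = ∑ q ∈ Finset.range N, g (k + q) := by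
    have h := (Finset.sum_range_succ' (fun q : ℕ => g (k + q)) N).symm.trans
      (Finset.sum_range_succ (fun q : ℕ => g (k + q)) N)
    rw [hg k, Nat.cast_zero, add_zero] at h
    rw [← add_right_cancel h]
    refine Finset.sum_congr rfl fun q _ => congrArg g ?_
    push_cast
    ring
  induction m with
  | zero => simp
  | succ k ih => rw [step, ih]
  | pred k ih => rw [← step, sub_add_cancel, ih]

theorem sum_range_natCast_mul_pow_mul_sub_one {R : Type*} [CommRing R] (w : R) (n : ℕ) :
    (∑ q ∈ Finset.range n, (q : R) * w ^ q) * (w - 1) =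
      n * w ^ n - w * ∑ q ∈ Finset.range n, w ^ q := by
  induction n with
  | zero => simp
  | succ n ih =>
    rw [Finset.sum_range_succ, Finset.sum_range_succ, add_mul, ih]
    push_cast
    ring

/-- for `N ≥ 2`, `x : ℝ`, `y : ℤ` not divisible by `N`, and
`ζ = exp(2πi/N)`, one has `∑_{q=0}^{N-1} ζ^{yq} b₁((x+q)/N) = ζ^{-y⌊x⌋}/(ζ^y - 1)`. -/
theorem stmt0 (N : ℕ) (hN : 2 ≤ N) (x : ℝ) (y : ℤ) (hy : ¬ ((N : ℤ) ∣ y)) :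
    ∑ q ∈ Finset.range N,
        Complex.exp (2 * Real.pi * Complex.I / N) ^ (y * (q : ℤ)) *
          ((periodicBernoulli 1 ((x + (q : ℝ)) / N) : ℝ) : ℂ) =
      Complex.exp (2 * Real.pi * Complex.I / N) ^ (-(y * ⌊x⌋)) /
        (Complex.exp (2 * Real.pi * Complex.I / N) ^ y - 1) := by
  have hN0 : N ≠ 0 := by omega
  have hNR : (0 : ℝ) < N := by positivity
  have hNC : (N : ℂ) ≠ 0 := by exact_mod_cast hN0
  have hprim := Complex.isPrimitiveRoot_exp N hN0
  have hζ := hprim.ne_zero hN0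
  generalize Complex.exp (2 * Real.pi * Complex.I / N) = ζ at *
  simp only [← mul_neg, zpow_mul]
  have hw1 : ζ ^ y - 1 ≠ 0 := fun h => hy ((hprim.zpow_eq_one_iff_dvd y).1 (sub_eq_zero.1 h))
  have hw0 : ζ ^ y ≠ 0 := zpow_ne_zero _ hζ
  have hwN : (ζ ^ y) ^ N = 1 := by
    rw [← zpow_natCast, zpow_comm, zpow_natCast, hprim.pow_eq_one, one_zpow]
  generalize ζ ^ y = w at *
  have hgeom : ∑ q ∈ Finset.range N, w ^ q = 0 :=
    (mul_eq_zero.1 ((geom_sum_mul w N).trans (by rw [hwN, sub_self]))).resolve_right hw1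
  have hweighted := sum_range_natCast_mul_pow_mul_sub_one w N
  rw [hgeom, hwN, mul_zero, sub_zero, mul_one] at hweighted
  have hper : Function.Periodic
      (fun n : ℤ => w ^ n * ((periodicBernoulli 1 ((x + (n : ℝ)) / N) : ℝ) : ℂ)) (N : ℤ) := by
    intro n
    have harg : (x + ((n + (N : ℤ) : ℤ) : ℝ)) / N = (x + n) / N + 1 := by
      push_cast
      field_simp
      ring
    simp only [harg, periodicBernoulli_one, Int.fract_add_one, zpow_add₀ hw0, zpow_natCast, hwN,
      mul_one]
  have hshift := hper.sum_range_int_add (-⌊x⌋)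
  simp only [Int.cast_natCast] at hshift
  rw [← hshift]
  have hterm : ∀ q ∈ Finset.range N,
      w ^ (-⌊x⌋ + (q : ℤ)) *
        ((periodicBernoulli 1 ((x + ((-⌊x⌋ + (q : ℤ) : ℤ) : ℝ)) / N) : ℝ) : ℂ) =
      w ^ (-⌊x⌋) * ((((Int.fract x : ℝ) : ℂ) / N - 1 / 2) * w ^ q + (q * w ^ q) / N) := by
    intro q hq
    have hqN : (q : ℝ) + 1 ≤ N := by exact_mod_cast Finset.mem_range.1 hq
    have harg : (x + ((-⌊x⌋ + (q : ℤ) : ℤ) : ℝ)) / N = (Int.fract x + q) / N := by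
      rw [Int.fract]
      push_cast
      ring
    have hfract : Int.fract ((Int.fract x + q) / N) = (Int.fract x + q) / N := by
      refine Int.fract_eq_self.2 ⟨?_, ?_⟩
      · have := Int.fract_nonneg x
        positivity
      · rw [div_lt_one hNR]
        linarith [Int.fract_lt_one x]
    rw [harg, periodicBernoulli_one, hfract, zpow_add₀ hw0, zpow_natCast]
    push_cast
    ring
  rw [Finset.sum_congr rfl hterm, ← Finset.mul_sum, Finset.sum_add_distrib, ← Finset.mul_sum,
    hgeom, ← Finset.sum_div, mul_zero, zero_add, eq_div_iff hw1, mul_assoc, div_mul_eq_mul_div,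
    hweighted, div_self hNC, mul_one]
end

section
/- Let N ≥ 2 and n ≥ 1 be integers and let α₁, …, α_n be integers each coprime to N. Let s₁, …, s_n be positive integers, let t₁, …, t_n be real numbers, and let r₁, …, r_n be integers. Let k₁, …, k_n be nonnegative integers with k₁ + ⋯ + k_n ≤ n and such that k_{j₀} = 0 for at least one index j₀. Then N · Σ_{q ∈ Q} Π_{j=1}^{n} N^{k_j − 1} · b_{k_j}( (t_j + (r_j + q_j)·s_j) / (N·s_j) ) = Π_{j=1}^{n} b_{k_j}( t_j / s_j ). -/
open Finset in
/-- The multiplication theorem for Bernoulli polynomials. -/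
theorem Polynomial.sum_bernoulli_comp (N : ℕ) (hN : N ≠ 0) (k : ℕ) :
    C ((N : ℚ) ^ k) * ∑ i ∈ range N, (bernoulli k).comp (C (N : ℚ)⁻¹ * (X + C (i : ℚ))) =
      C (N : ℚ) * bernoulli k := by
  have hN' : (N : ℚ) ≠ 0 := by exact_mod_cast hN
  -- In degree `k + 1` the two sides differ by a `1`-periodic polynomial, i.e. a constant;
  -- differentiating gives the claim in degree `k`.
  set D : Polynomial ℚ := C ((N : ℚ) ^ (k + 1)) *
      ∑ i ∈ range N, (bernoulli (k + 1)).comp (C (N : ℚ)⁻¹ * (X + C (i : ℚ))) -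
        C (N : ℚ) * bernoulli (k + 1) with hD
  have hper : ∀ x : ℚ, D.eval (x + 1) = D.eval x := by
    intro x
    have htel := sum_range_sub
      (fun i : ℕ => (bernoulli (k + 1)).eval ((N : ℚ)⁻¹ * (x + i))) N
    have hend : (N : ℚ)⁻¹ * (x + N) = 1 + (N : ℚ)⁻¹ * x := by field_simp; ring
    simp only [hend, bernoulli_eval_one_add, sum_sub_distrib, Nat.cast_zero, add_zero] at htel
    have hshift : ∑ i ∈ range N, (bernoulli (k + 1)).eval ((N : ℚ)⁻¹ * (x + 1 + i)) =
        ∑ i ∈ range N, (bernoulli (k + 1)).eval ((N : ℚ)⁻¹ * (x + ((i + 1 : ℕ) : ℚ))) :=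
      sum_congr rfl fun i _ => by push_cast; ring_nf
    have hone := bernoulli_eval_one_add (k + 1) x
    rw [add_comm] at hone
    have hpow : (N : ℚ) ^ (k + 1) * ((N : ℚ)⁻¹ * x) ^ k = N * x ^ k := by
      rw [mul_pow, inv_pow, pow_succ]; field_simp
    simp only [hD, eval_sub, eval_mul, eval_C, eval_finsetSum, eval_comp, eval_add, eval_X,
      hshift, hone]
    simp only [Nat.add_sub_cancel] at htel ⊢
    linear_combination (N : ℚ) ^ (k + 1) * htel + ((k + 1 : ℕ) : ℚ) * hpow
  have hconst : D = C (D.eval 0) := by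
    apply eq_of_infinite_eval_eq
    refine (Set.infinite_range_of_injective (Nat.cast_injective (R := ℚ))).mono ?_
    rintro _ ⟨m, rfl⟩
    simp only [Set.mem_ofPred_eq, eval_C]
    induction m with
    | zero => simp
    | succ m ih => rw [Nat.cast_succ, hper, ih]
  have hder : derivative D = 0 := by rw [hconst, derivative_C]
  rw [hD] at hder
  simp only [derivative_sub, derivative_C_mul, derivative_sum, derivative_comp,
    derivative_bernoulli_add_one, derivative_add, derivative_X, derivative_C, add_zero,
    mul_one, mul_comp, add_comp, natCast_comp, one_comp] at hder
  rw [← mul_sum, ← mul_sum] at hder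
  have hk : ((k : Polynomial ℚ) + 1) ≠ 0 := by exact_mod_cast Nat.succ_ne_zero k
  have hC : C ((N : ℚ) ^ (k + 1)) * C (N : ℚ)⁻¹ = C ((N : ℚ) ^ k) := by
    rw [← C_mul, pow_succ, mul_assoc, mul_inv_cancel₀ hN', mul_one]
  apply mul_left_cancel₀ hk
  rw [← hC]
  linear_combination hder

theorem periodicBernoulli_zero (x : ℝ) : periodicBernoulli 0 x = 1 := by
  simp [periodicBernoulli]

theorem periodicBernoulli_add_int (k : ℕ) (x : ℝ) (m : ℤ) :
    periodicBernoulli k (x + m) = periodicBernoulli k x := by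
  simp [periodicBernoulli]

open Finset in
/-- Replacing `y` by `y + 1` permutes the points `(y + i) / N` modulo `1`. -/
theorem sum_periodicBernoulli_add_one (N : ℕ) (hN : N ≠ 0) (k : ℕ) (y : ℝ) :
    ∑ i ∈ range N, periodicBernoulli k ((y + 1 + i) / N) =
      ∑ i ∈ range N, periodicBernoulli k ((y + i) / N) := by
  have hN' : (N : ℝ) ≠ 0 := by exact_mod_cast hN
  have htel := sum_range_sub (fun i : ℕ => periodicBernoulli k ((y + i) / N)) N
  have hend : (y + N) / N = y / N + ((1 : ℤ) : ℝ) := by field_simp; simp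
  simp only [hend, periodicBernoulli_add_int, Nat.cast_zero, add_zero, sub_self,
    sum_sub_distrib] at htel
  rw [← sub_eq_zero, ← htel]
  congr 1
  exact sum_congr rfl fun i _ => by push_cast; ring_nf

open Finset in
/-- The distribution relation for periodic Bernoulli functions. -/
theorem sum_periodicBernoulli (N : ℕ) (hN : N ≠ 0) (k : ℕ) (y : ℝ) :
    ∑ i ∈ range N, (N : ℝ) ^ ((k : ℤ) - 1) * periodicBernoulli k ((y + i) / N) =
      periodicBernoulli k y := by
  have hN' : (N : ℝ) ≠ 0 := by exact_mod_cast hN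
  have hpos : (0 : ℝ) < N := by positivity
  have hper : Function.Periodic
      (fun y : ℝ => ∑ i ∈ range N, periodicBernoulli k ((y + i) / N)) 1 :=
    sum_periodicBernoulli_add_one N hN k
  have hfract : ∑ i ∈ range N, periodicBernoulli k ((y + i) / N) =
      ∑ i ∈ range N, periodicBernoulli k ((Int.fract y + i) / N) := by
    have := hper.sub_int_mul_eq (x := y) ⌊y⌋
    simp only [mul_one, Int.self_sub_floor] at this
    exact this.symm
  have heval : ∀ i ∈ range N, periodicBernoulli k ((Int.fract y + i) / N) =
      Polynomial.aeval ((N : ℝ)⁻¹ * (Int.fract y + i)) (Polynomial.bernoulli k) := by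
    intro i hi
    have hi' : (i : ℝ) + 1 ≤ N := by exact_mod_cast mem_range.mp hi
    have h0 := Int.fract_nonneg y
    have h1 := Int.fract_lt_one y
    rw [periodicBernoulli, Int.fract_eq_self.mpr ⟨by positivity, ?_⟩, div_eq_inv_mul]
    rw [div_lt_one hpos]
    linarith
  have hmul := congrArg (Polynomial.aeval (Int.fract y))
    (Polynomial.sum_bernoulli_comp N hN k)
  simp only [map_mul, map_sum, Polynomial.aeval_C, Polynomial.aeval_comp, map_add,
    Polynomial.aeval_X, map_pow, map_inv₀, map_natCast] at hmul
  rw [← mul_sum, hfract, sum_congr rfl heval, zpow_sub_one₀ hN', zpow_natCast, mul_right_comm,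
    hmul, periodicBernoulli]
  field_simp

/-- A linear congruence with invertible leading coefficient has one solution in `Fin N`. -/
theorem existsUnique_fin_dvd_mul_add (N : ℕ) (hN : N ≠ 0) (a c : ℤ)
    (ha : IsCoprime a (N : ℤ)) : ∃! x : Fin N, (N : ℤ) ∣ ((x : ℕ) : ℤ) * a + c := by
  have hpos : (0 : ℤ) < N := by omega
  obtain ⟨u, v, huv⟩ := ha
  have hnonneg := Int.emod_nonneg (-c * u) hpos.ne'
  have hlt := Int.emod_lt_of_pos (-c * u) hpos
  refine ⟨⟨((-c * u) % N).toNat, by omega⟩, ?_, ?_⟩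
  · simp only [Int.toNat_of_nonneg hnonneg]
    refine ⟨c * v - (-c * u / N) * a, ?_⟩
    linear_combination a * Int.emod_add_mul_ediv (-c * u) N - c * huv
  · intro x hx
    apply Fin.ext
    have hx' : ((x : ℕ) : ℤ) % N = (-c * u) % N := by
      refine Int.ModEq.symm ((Int.modEq_iff_dvd).mpr ?_)
      obtain ⟨w, hw⟩ := hx
      exact ⟨u * w + v * (x : ℕ), by linear_combination u * hw - (x : ℕ) * huv⟩
    rw [Int.emod_eq_of_lt (by positivity) (by exact_mod_cast x.isLt)] at hx'
    simp only [← hx', Int.toNat_natCast]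

open Finset in
/-- If one factor of a product is constant, then restricting the sum of the product over all
tuples to the solutions of a linear congruence with unit coefficients divides it by `N`. -/
theorem mul_sum_filter_dvd_prod {n N : ℕ} (hN : N ≠ 0) (α : Fin n → ℤ) (j₀ : Fin n)
    (hα : IsCoprime (α j₀) (N : ℤ)) (f : Fin n → Fin N → ℝ) (c : ℝ) (hf : ∀ i, f j₀ i = c) :
    (N : ℝ) * ∑ q ∈ univ.filter
        (fun q : Fin n → Fin N => (N : ℤ) ∣ ∑ j, ((q j : ℕ) : ℤ) * α j), ∏ j, f j (q j) =
      ∏ j, ∑ i, f j i := by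
  cases n with
  | zero => exact j₀.elim0
  | succ m =>
    rw [sum_filter, ← (Fin.insertNthEquiv (fun _ => Fin N) j₀).sum_comp, Fintype.sum_prod_type,
      sum_comm, Fin.prod_univ_succAbove _ j₀, prod_univ_sum, Fintype.piFinset_univ]
    simp only [Fin.insertNthEquiv_apply, Fin.sum_univ_succAbove _ j₀,
      Fin.prod_univ_succAbove _ j₀, Fin.insertNth_apply_same, Fin.insertNth_apply_succAbove, hf,
      sum_const, card_univ, Fintype.card_fin, nsmul_eq_mul]
    rw [mul_assoc, mul_sum (f := fun p : Fin m → Fin N => ∏ j, f (j₀.succAbove j) (p j))]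
    congr 1
    refine sum_congr rfl fun p _ => ?_
    obtain ⟨x, hx, huniq⟩ := existsUnique_fin_dvd_mul_add N hN (α j₀)
      (∑ j, ((p j : ℕ) : ℤ) * α (j₀.succAbove j)) hα
    rw [sum_eq_single x (fun y _ hy => if_neg fun h => hy (huniq y h)) (by simp), if_pos hx]

/-- distribution-type relation over the set
`Q = {q ∈ {0,…,N-1}^n : N ∣ ∑ q_j α_j}` for the periodic Bernoulli functions,
when some exponent `k_{j₀}` vanishes. -/
theorem stmt1 (N n : ℕ) (hN : 2 ≤ N) (hn : 1 ≤ n)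
    (α : Fin n → ℤ) (hα : ∀ j, IsCoprime (α j) (N : ℤ))
    (s : Fin n → ℤ) (hs : ∀ j, 0 < s j)
    (t : Fin n → ℝ) (r : Fin n → ℤ)
    (k : Fin n → ℕ) (hk : ∑ j, k j ≤ n) (hk0 : ∃ j₀, k j₀ = 0) :
    (N : ℝ) *
        ∑ q ∈ Finset.univ.filter
            (fun q : Fin n → Fin N => (N : ℤ) ∣ ∑ j, ((q j : ℕ) : ℤ) * α j),
          ∏ j, (N : ℝ) ^ ((k j : ℤ) - 1) *
            periodicBernoulli (k j)
              ((t j + ((r j : ℝ) + ((q j : ℕ) : ℝ)) * (s j : ℝ)) / ((N : ℝ) * (s j : ℝ)))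
      = ∏ j, periodicBernoulli (k j) (t j / (s j : ℝ)) := by
  obtain ⟨j₀, hj₀⟩ := hk0
  have hN0 : N ≠ 0 := by omega
  have hN' : (N : ℝ) ≠ 0 := by exact_mod_cast hN0
  rw [mul_sum_filter_dvd_prod hN0 α j₀ (hα j₀)
    (fun j i => (N : ℝ) ^ ((k j : ℤ) - 1) * periodicBernoulli (k j)
      ((t j + ((r j : ℝ) + ((i : ℕ) : ℝ)) * (s j : ℝ)) / ((N : ℝ) * (s j : ℝ))))
    ((N : ℝ) ^ ((k j₀ : ℤ) - 1)) (fun i => by simp only [hj₀, periodicBernoulli_zero, mul_one])]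
  refine Finset.prod_congr rfl fun j _ => ?_
  have hs' : (s j : ℝ) ≠ 0 := by exact_mod_cast (hs j).ne'
  rw [← periodicBernoulli_add_int (k j) (t j / s j) (r j), ← sum_periodicBernoulli N hN0,
    ← Fin.sum_univ_eq_sum_range (fun i : ℕ => (N : ℝ) ^ ((k j : ℤ) - 1) *
      periodicBernoulli (k j) ((t j / s j + r j + i) / N))]
  refine Finset.sum_congr rfl fun i _ => ?_
  congr 2
  field_simp
  ring
end

section
/- Let n ≥ 1 and N ≥ 2 be integers. Let α₁, …, α_n ∈ ℤ^n be ℚ-linearly independent vectors such that gcd((α_j)₁, N) = 1 for every j, where (α_j)₁ denotes the first coordinate of α_j. Let L = ℤ^n, let L′ = {x ∈ ℤ^n : N divides x₁}, let M be the subgroup of ℤ^n generated by α₁, …, α_n, and let M′ be the subgroup generated by N·α₁, …, N·α_n. Then M′ ⊆ L′ ∩ M, the group homomorphism L′/M′ → L/M induced by the inclusion L′ ⊆ L is surjective, and its kernel is isomorphic as an abelian group to Q = {q ∈ (ℤ/Nℤ)^n : Σ_{j=1}^{n} q_j·(α_j)₁ = 0 in ℤ/Nℤ}; in particular the kernel has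 cardinality N^{n−1}, so the map is N^{n−1}-to-1. -/
/-- The index-`N` smoothing sublattice `L' = {x ∈ ℤ^n : N ∣ x₁}` of `ℤ^n`. -/
def smoothingLattice (n N : ℕ) [NeZero n] : AddSubgroup (Fin n → ℤ) where
  carrier := {x | (N : ℤ) ∣ x 0}
  zero_mem' := dvd_zero _
  add_mem' := fun ha hb => dvd_add ha hb
  neg_mem' := fun h => dvd_neg.mpr h

/-- The subgroup `Q = {q ∈ (ℤ/Nℤ)^n : ∑_j q_j c_j = 0}` of `(ℤ/Nℤ)^n`. -/
def Qsubgroup (n N : ℕ) (c : Fin n → ℤ) : AddSubgroup (Fin n → ZMod N) where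
  carrier := {q | ∑ j, q j * ((c j : ℤ) : ZMod N) = 0}
  zero_mem' := by simp
  add_mem' := by
    intro a b ha hb
    simp only [Set.mem_setOf_eq] at ha hb ⊢
    simp [Pi.add_apply, add_mul, Finset.sum_add_distrib, ha, hb]
  neg_mem' := by
    intro a ha
    simp only [Set.mem_setOf_eq] at ha ⊢
    simp [Pi.neg_apply, neg_mul, Finset.sum_neg_distrib, ha]

/-- Membership in the subgroup generated by a finite family. -/
theorem mem_closure_range_iff_exists_sum {n : ℕ} {A : Type*} [AddCommGroup A]
    (v : Fin n → A) (x : A) :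
    x ∈ AddSubgroup.closure (Set.range v) ↔ ∃ a : Fin n → ℤ, ∑ j, a j • v j = x := by
  rw [← Submodule.mem_span_range_iff_exists_fun ℤ, ← Submodule.span_int_eq_addSubgroupClosure]
  rfl

/-- Integer vectors that are linearly independent over `ℚ` are so over `ℤ`. -/
theorem linearIndependent_int_of_rat {n : ℕ} (α : Fin n → Fin n → ℤ)
    (hind : LinearIndependent ℚ (fun j : Fin n => fun i : Fin n => ((α j i : ℤ) : ℚ))) :
    LinearIndependent ℤ α := by
  rw [Fintype.linearIndependent_iff] at hind ⊢
  intro g hg j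
  have key := hind (fun j => (g j : ℚ)) (by
    ext i
    have := congrFun hg i
    simp only [Finset.sum_apply, Pi.smul_apply, smul_eq_mul, Pi.zero_apply] at this ⊢
    exact_mod_cast this) j
  exact_mod_cast key

/-- The hyperplane orthogonal to a vector with a unit coordinate has `N ^ (n - 1)` points. -/
theorem card_Qsubgroup {n N : ℕ} [NeZero N] (c : Fin n → ℤ) (k : Fin n)
    (hk : IsUnit ((c k : ℤ) : ZMod N)) : Nat.card (Qsubgroup n N c) = N ^ (n - 1) := by
  let h : (Fin n → ZMod N) →+ ZMod N :=
    { toFun := fun q => ∑ j, q j * ((c j : ℤ) : ZMod N)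
      map_zero' := by simp
      map_add' := by intro a b; simp [add_mul, Finset.sum_add_distrib] }
  have hker : h.ker = Qsubgroup n N c := rfl
  have hsurj : Function.Surjective h := by
    intro y
    obtain ⟨u, hu⟩ := hk.exists_left_inv
    refine ⟨Pi.single k (y * u), ?_⟩
    change ∑ j, (Pi.single k (y * u) : Fin n → ZMod N) j * ((c j : ℤ) : ZMod N) = y
    rw [Finset.sum_eq_single k (by intro j _ hj; simp [hj]) (by simp)]
    simp [mul_assoc, hu]
  have hcard := AddSubgroup.card_eq_card_quotient_mul_card_addSubgroup h.ker
  rw [Nat.card_congr (QuotientAddGroup.quotientKerEquivOfSurjective h hsurj).toEquiv, hker] at hcard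
  have hn : n ≠ 0 := (Fin.pos k).ne'
  obtain ⟨m, rfl⟩ := Nat.exists_eq_succ_of_ne_zero hn
  simp only [Nat.card_fun, Nat.card_zmod, Nat.card_fin, pow_succ'] at hcard
  simpa using (Nat.eq_of_mul_eq_mul_left (NeZero.pos N) hcard).symm

/-- An integer combination of the `α j` lies in `L'` iff its coefficients modulo `N` lie in `Q`. -/
theorem sum_mem_smoothingLattice_iff {n N : ℕ} [NeZero n] (α : Fin n → Fin n → ℤ)
    (a : Fin n → ℤ) : ∑ j, a j • α j ∈ smoothingLattice n N ↔
      (fun j => (a j : ZMod N)) ∈ Qsubgroup n N (fun j => α j 0) := by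
  change (N : ℤ) ∣ (∑ j, a j • α j) 0 ↔ ∑ j, (a j : ZMod N) * ((α j 0 : ℤ) : ZMod N) = 0
  rw [← ZMod.intCast_zmod_eq_zero_iff_dvd]
  simp

/-- Reducing coordinates with respect to `α` modulo `N` identifies `(L' ∩ M) / M'` with `Q`. -/
theorem nonempty_quotient_addEquiv_Qsubgroup {n N : ℕ} [NeZero n] (α : Fin n → Fin n → ℤ)
    (hα : LinearIndependent ℤ α) :
    Nonempty
      ((↥(smoothingLattice n N ⊓ AddSubgroup.closure (Set.range α)) ⧸
          (AddSubgroup.closure (Set.range fun j => (N : ℤ) • α j)).addSubgroupOf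
            (smoothingLattice n N ⊓ AddSubgroup.closure (Set.range α)))
        ≃+ Qsubgroup n N (fun j => α j 0)) := by
  have inj : ∀ a b : Fin n → ℤ, ∑ j, a j • α j = ∑ j, b j • α j → a = b := fun a b h =>
    funext fun j => sub_eq_zero.1 (Fintype.linearIndependent_iff.1 hα (fun j => a j - b j)
      (by simp only [sub_smul, Finset.sum_sub_distrib, h, sub_self]) j)
  choose coeff hcoeff using fun
    x : ↥(smoothingLattice n N ⊓ AddSubgroup.closure (Set.range α)) =>
      (mem_closure_range_iff_exists_sum α x).1 x.2.2
  have coeff_add : ∀ x y, coeff (x + y) = coeff x + coeff y := fun x y => inj _ _ (by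
    simp only [Pi.add_apply, add_smul, Finset.sum_add_distrib, hcoeff, AddSubgroup.coe_add])
  let f : ↥(smoothingLattice n N ⊓ AddSubgroup.closure (Set.range α)) →+
      Qsubgroup n N (fun j => α j 0) :=
    AddMonoidHom.mk' (fun x => ⟨fun j => (coeff x j : ZMod N),
      (sum_mem_smoothingLattice_iff α _).1 (by rw [hcoeff]; exact x.2.1)⟩) (fun x y => by
        ext j
        simp [coeff_add])
  have hf : ∀ x j, (f x : Fin n → ZMod N) j = (coeff x j : ZMod N) := fun _ _ => rfl
  have hsurj : Function.Surjective f := by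
    intro q
    choose a ha using fun j => ZMod.intCast_surjective ((q : Fin n → ZMod N) j)
    have hq : (fun j => (a j : ZMod N)) = (q : Fin n → ZMod N) := funext ha
    let x : ↥(smoothingLattice n N ⊓ AddSubgroup.closure (Set.range α)) :=
      ⟨∑ j, a j • α j, AddSubgroup.mem_inf.2
        ⟨(sum_mem_smoothingLattice_iff α a).2 (hq ▸ q.2),
          (mem_closure_range_iff_exists_sum α _).2 ⟨a, rfl⟩⟩⟩
    refine ⟨x, ?_⟩
    ext j
    rw [hf, inj (coeff x) a (hcoeff x), ha]
  have hker : f.ker = (AddSubgroup.closure (Set.range fun j => (N : ℤ) • α j)).addSubgroupOf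
      (smoothingLattice n N ⊓ AddSubgroup.closure (Set.range α)) := by
    ext x
    rw [AddMonoidHom.mem_ker, AddSubgroup.mem_addSubgroupOf, mem_closure_range_iff_exists_sum]
    constructor
    · intro hx
      have hdvd : ∀ j, (N : ℤ) ∣ coeff x j := fun j => by
        rw [← ZMod.intCast_zmod_eq_zero_iff_dvd, ← hf, hx]
        rfl
      choose b hb using hdvd
      refine ⟨b, ?_⟩
      rw [← hcoeff x]
      exact Finset.sum_congr rfl fun j _ => by rw [hb, smul_smul, mul_comm]
    · rintro ⟨b, hb⟩
      have hx : coeff x = fun j => b j * (N : ℤ) := inj _ _ (by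
        rw [hcoeff, ← hb]
        simp only [smul_smul])
      ext j
      rw [hf, hx]
      simp
  exact ⟨(QuotientAddGroup.quotientAddEquivOfEq hker.symm).trans
    (QuotientAddGroup.quotientKerEquivOfSurjective f hsurj)⟩

/-- for ℚ-linearly independent `α₁,…,α_n ∈ ℤ^n` whose first
coordinates are prime to `N`, with `L = ℤ^n`, `L' = {x : N ∣ x₁}`,
`M = ⟨α₁,…,α_n⟩` and `M' = ⟨Nα₁,…,Nα_n⟩`: one has `M' ⊆ L' ∩ M`, the natural
map `L' → L/M` (hence the induced map `L'/M' → L/M`) is surjective, and the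
kernel of the induced map, namely `(L' ∩ M)/M'`, is isomorphic as an abelian
group to `Q = {q ∈ (ℤ/Nℤ)^n : ∑ q_j (α_j)₁ = 0}`, which has cardinality
`N^{n-1}`; so the induced map is `N^{n-1}`-to-one. -/
theorem stmt8 (n N : ℕ) [NeZero n] (hn : 1 ≤ n) (hN : 2 ≤ N)
    (α : Fin n → Fin n → ℤ)
    (hind : LinearIndependent ℚ (fun j : Fin n => fun i : Fin n => ((α j i : ℤ) : ℚ)))
    (hcop : ∀ j, IsCoprime (α j 0) (N : ℤ)) :
    AddSubgroup.closure (Set.range fun j => (N : ℤ) • α j)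
        ≤ smoothingLattice n N ⊓ AddSubgroup.closure (Set.range α) ∧
      Function.Surjective
        ((QuotientAddGroup.mk' (AddSubgroup.closure (Set.range α))).comp
          (smoothingLattice n N).subtype) ∧
      Nonempty
        ((↥(smoothingLattice n N ⊓ AddSubgroup.closure (Set.range α)) ⧸
            (AddSubgroup.closure (Set.range fun j => (N : ℤ) • α j)).addSubgroupOf
              (smoothingLattice n N ⊓ AddSubgroup.closure (Set.range α)))
          ≃+ Qsubgroup n N (fun j => α j 0)) ∧
      Nat.card (Qsubgroup n N (fun j => α j 0)) = N ^ (n - 1) := by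
  have hN0 : NeZero N := ⟨by omega⟩
  refine ⟨?_, ?_, nonempty_quotient_addEquiv_Qsubgroup α (linearIndependent_int_of_rat α hind),
    card_Qsubgroup _ 0 ?_⟩
  · rw [AddSubgroup.closure_le]
    rintro _ ⟨j, rfl⟩
    exact ⟨Dvd.intro _ rfl,
      AddSubgroup.zsmul_mem _ (AddSubgroup.subset_closure (Set.mem_range_self j)) _⟩
  · intro y
    obtain ⟨x, rfl⟩ := QuotientAddGroup.mk'_surjective _ y
    obtain ⟨u, v, huv⟩ := hcop 0
    refine ⟨⟨x - (x 0 * u) • α 0, ⟨x 0 * v, ?_⟩⟩, ?_⟩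
    · simp only [Pi.sub_apply, Pi.smul_apply, smul_eq_mul]
      linear_combination (-x 0) * huv
    · refine (QuotientAddGroup.eq_iff_sub_mem).2 ?_
      simpa using AddSubgroup.zsmul_mem _
        (AddSubgroup.subset_closure (Set.mem_range_self (f := α) 0)) (x 0 * u)
  · obtain ⟨u, v, huv⟩ := hcop 0
    refine IsUnit.of_mul_eq_one_right (u : ZMod N) ?_
    simpa using congrArg (Int.cast : ℤ → ZMod N) huv
end

section
/- Let I be a finite index set, let λ : I → ℝ satisfy λ_i ≠ 0 for all i ∈ I, and let E assign to every ordered pair (j,k) of distinct elements of I a sign E(j,k) ∈ {−1, +1} satisfying: for all distinct j, k, E(j,k) = −E(k,j) if λ_j·λ_k > 0, and E(j,k) = E(k,j) if λ_j·λ_k < 0. Call two distinct indices j, j′ ∈ I compatible if E(j,k) = E(j′,k) for every k ∈ I ∖ {j, j′}. Then for any three pairwise distinct indices j, j′, j″ ∈ I: if j and j′ are compatible and j′ and j″ are compatible, then j and j″ are NOT compatible. -/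
/-- with `E` a sign table as in the antisymmetry setup, call two
distinct indices `j, j'` compatible if `E(j,k) = E(j',k)` for all
`k ∈ I ∖ {j, j'}`. Then for pairwise distinct `j, j', j''`: if `j, j'` are
compatible and `j', j''` are compatible, then `j, j''` are NOT compatible. -/
theorem stmt11 (I : Type*) [Fintype I] (lam : I → ℝ) (hlam : ∀ i, lam i ≠ 0)
    (E : I → I → ℤ) (hE : ∀ j k, j ≠ k → E j k = 1 ∨ E j k = -1)
    (hanti : ∀ j k, j ≠ k →
      (0 < lam j * lam k → E j k = -E k j) ∧ (lam j * lam k < 0 → E j k = E k j)) :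
    ∀ j j' j'' : I, j ≠ j' → j ≠ j'' → j' ≠ j'' →
      (∀ k, k ≠ j → k ≠ j' → E j k = E j' k) →
      (∀ k, k ≠ j' → k ≠ j'' → E j' k = E j'' k) →
      ¬ (∀ k, k ≠ j → k ≠ j'' → E j k = E j'' k) := by
  intro a b c hab hac hbc h₁ h₂ h₃
  have hc := h₁ c hac.symm hbc.symm
  have ha := h₂ a hab hac
  have hb := h₃ b hab.symm hbc
  have hEab := hE a b hab
  have hEac := hE a c hac
  have hEba := hE b a hab.symm
  obtain ⟨pab, nab⟩ := hanti a b hab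
  obtain ⟨pac, nac⟩ := hanti a c hac
  obtain ⟨pbc, nbc⟩ := hanti b c hbc
  rcases (hlam a).lt_or_gt with sa | sa <;> rcases (hlam b).lt_or_gt with sb | sb <;>
    rcases (hlam c).lt_or_gt with sc | sc <;>
    simp only [mul_pos_iff, mul_neg_iff, sa, sb, sc, sa.not_gt, sb.not_gt, sc.not_gt,
      and_true, and_false, or_true, or_false, false_imp_iff, true_imp_iff]
      at pab nab pac nac pbc nbc <;>
    omega
end

section
/- Let I be a finite index set, let λ : I → ℝ satisfy λ_i ≠ 0 for all i ∈ I, and let E assign to every ordered pair (j,k) of distinct elements of I a sign E(j,k) ∈ {−1, +1} satisfying: for all distinct j, k, E(j,k) = −E(k,j) if λ_j·λ_k > 0, and E(j,k) = E(k,j) if λ_j·λ_k < 0. Let V be a real vector space and let a_k : V → ℝ be linear forms for k ∈ I. For each j ∈ I define the cone C_j = {δ ∈ V : for every k ∈ I ∖ {j}, a_k(δ) > 0 if E(j,k) = +1, and a_k(δ) ≤ 0 if E(j,k) = −1}. Then for any three pairwise distinct indices j, j′, j″ ∈ I, the triple intersection C_j ∩ C_{j′} ∩ C_{j″} is empty.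 -/
/-- The cone `C_j = {δ ∈ V : ∀ k ≠ j, a_k(δ) > 0 if E(j,k) = 1 and
a_k(δ) ≤ 0 if E(j,k) = -1}` cut out by the sign data `E` and linear forms `a`. -/
def signCone {I V : Type*} [AddCommGroup V] [Module ℝ V]
    (E : I → I → ℤ) (a : I → V →ₗ[ℝ] ℝ) (j : I) : Set V :=
  {δ | ∀ k, k ≠ j → (E j k = 1 → 0 < a k δ) ∧ (E j k = -1 → a k δ ≤ 0)}

/-- The sign table determines on which side of each hyperplane a point of the cone lies. -/
theorem eq_one_iff_pos_of_mem_signCone {I V : Type*} [AddCommGroup V] [Module ℝ V]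
    {E : I → I → ℤ} {a : I → V →ₗ[ℝ] ℝ} {j k : I} {δ : V} (hδ : δ ∈ signCone E a j)
    (hkj : k ≠ j) (hE : E j k = 1 ∨ E j k = -1) : E j k = 1 ↔ 0 < a k δ := by
  refine ⟨(hδ k hkj).1, fun hpos => hE.resolve_right fun hneg => ?_⟩
  exact ((hδ k hkj).2 hneg).not_gt hpos

/-- At a common point of two cones `C_j` and `C_k`, the forms `a_j` and `a_k` lie on opposite
sides exactly when `λ_j` and `λ_k` have the same sign. -/
theorem lam_pos_iff_iff_of_mem_signCone {I V : Type*} [AddCommGroup V] [Module ℝ V]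
    {lam : I → ℝ} {E : I → I → ℤ} {a : I → V →ₗ[ℝ] ℝ} {j k : I} {δ : V}
    (hj : lam j ≠ 0) (hk : lam k ≠ 0)
    (hE : ∀ j k, j ≠ k → E j k = 1 ∨ E j k = -1)
    (hanti : (0 < lam j * lam k → E j k = -E k j) ∧ (lam j * lam k < 0 → E j k = E k j))
    (hjk : j ≠ k) (hδj : δ ∈ signCone E a j) (hδk : δ ∈ signCone E a k) :
    (0 < lam j ↔ 0 < lam k) ↔ ¬(0 < a j δ ↔ 0 < a k δ) := by
  rw [← eq_one_iff_pos_of_mem_signCone hδj hjk.symm (hE j k hjk),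
    ← eq_one_iff_pos_of_mem_signCone hδk hjk (hE k j hjk.symm)]
  have hEjk := hE j k hjk
  have hEkj := hE k j hjk.symm
  rcases hj.lt_or_gt with hj | hj <;> rcases hk.lt_or_gt with hk | hk
  · have h := hanti.1 (mul_pos_of_neg_of_neg hj hk)
    grind
  · have h := hanti.2 (mul_neg_of_neg_of_pos hj hk)
    grind
  · have h := hanti.2 (mul_neg_of_pos_of_neg hj hk)
    grind
  · have h := hanti.1 (mul_pos hj hk)
    grind

/-- with `E` a sign table satisfying the antisymmetry relation
determined by a family of nonzero reals `λ`, any triple intersection of the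
cones `C_j` is empty. -/
theorem stmt12 (I : Type*) [Fintype I] (lam : I → ℝ) (hlam : ∀ i, lam i ≠ 0)
    (E : I → I → ℤ) (hE : ∀ j k, j ≠ k → E j k = 1 ∨ E j k = -1)
    (hanti : ∀ j k, j ≠ k →
      (0 < lam j * lam k → E j k = -E k j) ∧ (lam j * lam k < 0 → E j k = E k j))
    (V : Type*) [AddCommGroup V] [Module ℝ V] (a : I → V →ₗ[ℝ] ℝ) :
    ∀ j j' j'' : I, j ≠ j' → j ≠ j'' → j' ≠ j'' →
      signCone E a j ∩ signCone E a j' ∩ signCone E a j'' = ∅ := by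
  intro j j' j'' h₁ h₂ h₃
  refine Set.eq_empty_iff_forall_notMem.2 fun δ ⟨⟨hδ, hδ'⟩, hδ''⟩ => ?_
  have hjj' := lam_pos_iff_iff_of_mem_signCone (hlam j) (hlam j') hE (hanti j j' h₁) h₁ hδ hδ'
  have hjj'' := lam_pos_iff_iff_of_mem_signCone (hlam j) (hlam j'') hE (hanti j j'' h₂) h₂ hδ hδ''
  have hj'j'' :=
    lam_pos_iff_iff_of_mem_signCone (hlam j') (hlam j'') hE (hanti j' j'' h₃) h₃ hδ' hδ''
  tauto
end

section
/- Let I be a finite index set, let λ : I → ℝ satisfy λ_i ≠ 0 for all i ∈ I, and let E assign to every ordered pair (j,k) of distinct elements of I a sign E(j,k) ∈ {−1, +1} satisfying: for all distinct j, k, E(j,k) = −E(k,j) if λ_j·λ_k > 0, and E(j,k) = E(k,j) if λ_j·λ_k < 0. Call two distinct indices j, j′ compatible if E(j,k) = E(j′,k) for every k ∈ I ∖ {j, j′}. Let V be a real vector space, let a_k : V → ℝ be linear forms for k ∈ I, and for each j ∈ I define C_j = {δ ∈ V : for every k ∈ I ∖ {j}, a_k(δ) > 0 if E(j,k) = +1,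 and a_k(δ) ≤ 0 if E(j,k) = −1}. Then for any three pairwise distinct indices j, j′, j″ ∈ I such that j′ is compatible with j and j″ is compatible with j, one has C_j ⊆ C_{j′} ∪ C_{j″}. -/
/-- Two distinct indices `j'`, `j''` compatible with `j` have opposite signs in row `j`: the three
antisymmetry signs around the triangle `j`, `j'`, `j''` multiply to `-1`. -/
theorem sign_eq_neg_of_compatible {I : Type*} {lam : I → ℝ} (hlam : ∀ i, lam i ≠ 0)
    {E : I → I → ℤ}
    (hanti : ∀ j k, j ≠ k →
      (0 < lam j * lam k → E j k = -E k j) ∧ (lam j * lam k < 0 → E j k = E k j))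
    {j j' j'' : I} (h₁ : j ≠ j') (h₂ : j ≠ j'') (h₃ : j' ≠ j'')
    (hc' : E j j'' = E j' j'') (hc'' : E j j' = E j'' j') : E j' j = -E j'' j := by
  have a₁ := hanti j j' h₁
  have a₂ := hanti j j'' h₂
  have a₃ := hanti j' j'' h₃
  rcases (hlam j).lt_or_gt with p | p <;> rcases (hlam j').lt_or_gt with q | q <;>
    rcases (hlam j'').lt_or_gt with r | r <;>
    simp only [mul_pos_iff, mul_neg_iff, p, q, r, p.not_gt, q.not_gt, r.not_gt, and_self,
      and_true, and_false, or_true, or_false, true_imp_iff, false_imp_iff, true_and]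
      at a₁ a₂ a₃ <;>
    omega

/-- A point of `C_j` lies in `C_{j'}` for `j'` compatible with `j` as soon as it satisfies the
sign condition at `j`. -/
theorem mem_signCone_of_compatible {I V : Type*} [AddCommGroup V] [Module ℝ V]
    {E : I → I → ℤ} {a : I → V →ₗ[ℝ] ℝ} {j j' : I} {δ : V}
    (hc : ∀ k, k ≠ j → k ≠ j' → E j k = E j' k) (hδ : δ ∈ signCone E a j)
    (hj : (E j' j = 1 → 0 < a j δ) ∧ (E j' j = -1 → a j δ ≤ 0)) : δ ∈ signCone E a j' := by
  intro k hk
  by_cases hkj : k = j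
  · subst hkj
    exact hj
  · rw [← hc k hkj hk]
    exact hδ k hkj

/-- with `E` a sign table satisfying the antisymmetry relation
determined by a family of nonzero reals `λ`, if `j'` and `j''` are both
compatible with `j` (columns agree off the relevant rows), then
`C_j ⊆ C_{j'} ∪ C_{j''}`. -/
theorem stmt13 (I : Type*) [Fintype I] (lam : I → ℝ) (hlam : ∀ i, lam i ≠ 0)
    (E : I → I → ℤ) (hE : ∀ j k, j ≠ k → E j k = 1 ∨ E j k = -1)
    (hanti : ∀ j k, j ≠ k →
      (0 < lam j * lam k → E j k = -E k j) ∧ (lam j * lam k < 0 → E j k = E k j))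
    (V : Type*) [AddCommGroup V] [Module ℝ V] (a : I → V →ₗ[ℝ] ℝ) :
    ∀ j j' j'' : I, j ≠ j' → j ≠ j'' → j' ≠ j'' →
      (∀ k, k ≠ j → k ≠ j' → E j k = E j' k) →
      (∀ k, k ≠ j → k ≠ j'' → E j k = E j'' k) →
      signCone E a j ⊆ signCone E a j' ∪ signCone E a j'' := by
  intro j j' j'' h₁ h₂ h₃ hc' hc'' δ hδ
  have hopp := sign_eq_neg_of_compatible hlam hanti h₁ h₂ h₃
    (hc' j'' h₂.symm h₃.symm) (hc'' j' h₁.symm h₃)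
  have hsign := hE j' j h₁.symm
  by_cases hj : (E j' j = 1 → 0 < a j δ) ∧ (E j' j = -1 → a j δ ≤ 0)
  · exact Or.inl (mem_signCone_of_compatible hc' hδ hj)
  · refine Or.inr (mem_signCone_of_compatible hc'' hδ ?_)
    rcases hsign with h | h
    · have h' : E j'' j = -1 := by omega
      simpa [h, h'] using hj
    · have h' : E j'' j = 1 := by omega
      simpa [h, h'] using hj
end

section
/- Let n ≥ 2 be an integer and let j ≠ j′ be two indices in {1, …, n}. Let λ_j and λ_{j′} be nonzero real numbers, and let d^{(j)}_k ∈ {−1, +1} for k ∈ {1, …, n} ∖ {j} and d^{(j′)}_k ∈ {−1, +1} for k ∈ {1, …, n} ∖ {j′} be two families of signs. Set ε_j = (−1)^{j+n}·sign(λ_j) and ε_{j′} = (−1)^{j′+n}·sign(λ_{j′}); set D_j = Σ_{k ≠ j} (d^{(j)}_k − 1)/2 and D_{j′} = Σ_{k ≠ j′} (d^{(j′)}_k − 1)/2; and define μ_j = (−1)^{j+1+D_j+n} if ε_j = +1 and μ_j = (−1)^{j+1+D_j} if ε_j = −1, and similarly μ_{j′}. Assume: (a) ε_j·d^{(j)}_k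 = ε_{j′}·d^{(j′)}_k for every k ∈ {1, …, n} ∖ {j, j′}; and (b) ε_j·d^{(j)}_{j′} = −sign(λ_j·λ_{j′})·ε_{j′}·d^{(j′)}_j. Then μ_j = −μ_{j′}. -/
/-- The parity of the number of negative signs in a finite family is given by its product. -/
theorem neg_one_zpow_sum_half_sub_one {ι : Type*} (s : Finset ι) (d : ι → ℤ)
    (hd : ∀ k ∈ s, d k = 1 ∨ d k = -1) :
    (-1 : ℝ) ^ (∑ k ∈ s, (d k - 1) / 2) = ((∏ k ∈ s, d k : ℤ) : ℝ) := by
  classical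
  induction s using Finset.induction_on with
  | empty => simp
  | insert a s ha ih =>
    rw [Finset.sum_insert ha, Finset.prod_insert ha, zpow_add₀ (by norm_num),
      ih fun k hk => hd k (Finset.mem_insert_of_mem hk)]
    rcases hd a (Finset.mem_insert_self a s) with h | h <;> norm_num [h]

/-- If `ε = (-1)^(j+n) σ` for a sign `σ`, then the sign `μ` attached to `j` equals
`-σ ∏_{k ≠ j} ε d_k`. -/
theorem mu_eq_neg_sign_mul_prod {n j : ℕ} (hj : j ∈ Finset.Icc 1 n) (d : ℕ → ℤ)
    (hd : ∀ k ∈ Finset.Icc 1 n, k ≠ j → d k = 1 ∨ d k = -1) (ε σ : ℤ)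
    (hσ : σ = 1 ∨ σ = -1) (hε : ε = (-1) ^ (j + n) * σ) :
    (if ε = 1 then
        (-1 : ℝ) ^ ((j : ℤ) + 1 + (∑ k ∈ (Finset.Icc 1 n).erase j, (d k - 1) / 2) + (n : ℤ))
      else (-1 : ℝ) ^ ((j : ℤ) + 1 + ∑ k ∈ (Finset.Icc 1 n).erase j, (d k - 1) / 2)) =
      ((-σ * ∏ k ∈ (Finset.Icc 1 n).erase j, ε * d k : ℤ) : ℝ) := by
  have hprod := neg_one_zpow_sum_half_sub_one ((Finset.Icc 1 n).erase j) d fun k hk =>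
    hd k (Finset.mem_of_mem_erase hk) (Finset.ne_of_mem_erase hk)
  have hne : (-1 : ℝ) ≠ 0 := by norm_num
  rw [Finset.prod_mul_distrib, Finset.prod_const, Finset.card_erase_of_mem hj, Nat.card_Icc]
  simp only [zpow_add₀ hne, hprod, zpow_natCast, zpow_one]
  obtain ⟨m, rfl⟩ : ∃ m, n = m + 1 :=
    ⟨n - 1, by have := Finset.mem_Icc.mp hj; omega⟩
  simp only [Nat.add_sub_cancel]
  generalize ∏ k ∈ (Finset.Icc 1 (m + 1)).erase j, d k = P
  subst hε
  have hcast : ∀ i : ℕ, (-1 : ℝ) ^ i = (((-1) ^ i : ℤ) : ℝ) := fun i => by push_cast; rfl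
  rcases neg_one_pow_eq_or ℤ j with h | h <;> rcases neg_one_pow_eq_or ℤ m with h' | h' <;>
    rcases hσ with rfl | rfl <;> simp [pow_add, hcast j, hcast m, h, h']

/-- with `ε_j = (-1)^{j+n} sign(λ_j)`,
`D_j = ∑_{k ≠ j} (d^{(j)}_k - 1)/2`, and
`μ_j = (-1)^{j+1+D_j+n}` if `ε_j = 1`, `μ_j = (-1)^{j+1+D_j}` if `ε_j = -1`
(and similarly for `j'`), the hypotheses
(a) `ε_j d^{(j)}_k = ε_{j'} d^{(j')}_k` for all `k ∈ {1,…,n} ∖ {j, j'}` and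
(b) `ε_j d^{(j)}_{j'} = -sign(λ_j λ_{j'}) ε_{j'} d^{(j')}_j`
imply `μ_j = -μ_{j'}`. -/
theorem stmt15 (n : ℕ) (hn : 2 ≤ n) (j j' : ℕ)
    (hj : j ∈ Finset.Icc 1 n) (hj' : j' ∈ Finset.Icc 1 n) (hjj' : j ≠ j')
    (lj lj' : ℝ) (hlj : lj ≠ 0) (hlj' : lj' ≠ 0)
    (d d' : ℕ → ℤ)
    (hd : ∀ k ∈ Finset.Icc 1 n, k ≠ j → d k = 1 ∨ d k = -1)
    (hd' : ∀ k ∈ Finset.Icc 1 n, k ≠ j' → d' k = 1 ∨ d' k = -1)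
    (εj εj' Dj Dj' : ℤ) (μj μj' : ℝ)
    (hεj : εj = (-1) ^ (j + n) * (if 0 < lj then 1 else -1))
    (hεj' : εj' = (-1) ^ (j' + n) * (if 0 < lj' then 1 else -1))
    (hDj : Dj = ∑ k ∈ (Finset.Icc 1 n).erase j, (d k - 1) / 2)
    (hDj' : Dj' = ∑ k ∈ (Finset.Icc 1 n).erase j', (d' k - 1) / 2)
    (hμj : μj = if εj = 1 then (-1 : ℝ) ^ ((j : ℤ) + 1 + Dj + (n : ℤ))
      else (-1 : ℝ) ^ ((j : ℤ) + 1 + Dj))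
    (hμj' : μj' = if εj' = 1 then (-1 : ℝ) ^ ((j' : ℤ) + 1 + Dj' + (n : ℤ))
      else (-1 : ℝ) ^ ((j' : ℤ) + 1 + Dj'))
    (ha : ∀ k ∈ Finset.Icc 1 n, k ≠ j → k ≠ j' → εj * d k = εj' * d' k)
    (hb : εj * d j' = -(if 0 < lj * lj' then 1 else -1) * εj' * d' j) :
    μj = -μj' := by
  have hsign : ∀ x : ℝ, (if 0 < x then (1 : ℤ) else -1) = 1 ∨
      (if 0 < x then (1 : ℤ) else -1) = -1 := fun x => by split_ifs <;> simp
  have hmul : (if 0 < lj * lj' then (1 : ℤ) else -1) =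
      (if 0 < lj then 1 else -1) * (if 0 < lj' then 1 else -1) := by
    rcases lt_or_gt_of_ne hlj with h | h <;> rcases lt_or_gt_of_ne hlj' with h' | h' <;>
      simp [h, h', h.not_gt, h'.not_gt, mul_pos_of_neg_of_neg]
  rw [hmul] at hb
  subst hDj hDj'
  rw [mu_eq_neg_sign_mul_prod hj d hd εj _ (hsign lj) hεj] at hμj
  rw [mu_eq_neg_sign_mul_prod hj' d' hd' εj' _ (hsign lj') hεj'] at hμj'
  rw [← Finset.mul_prod_erase _ _ (Finset.mem_erase.mpr ⟨hjj'.symm, hj'⟩), hb] at hμj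
  rw [← Finset.mul_prod_erase _ _ (Finset.mem_erase.mpr ⟨hjj', hj⟩),
    Finset.erase_right_comm] at hμj'
  have hcommon : ∏ k ∈ ((Finset.Icc 1 n).erase j).erase j', εj * d k =
      ∏ k ∈ ((Finset.Icc 1 n).erase j).erase j', εj' * d' k :=
    Finset.prod_congr rfl fun k hk => by
      simp only [Finset.mem_erase] at hk
      exact ha k hk.2.2 hk.2.1 hk.1
  rw [hμj, hμj', hcommon, ← Int.cast_neg]
  congr 1
  rcases hsign lj with h | h <;> rw [h] <;> ring
end

section
/- Let I be a finite index set, let λ : I → ℝ satisfy λ_i ≠ 0 for all i ∈ I, and let E assign to every ordered pair (j,k) of distinct elements of I a sign E(j,k) ∈ {−1, +1} satisfying: for all distinct j, k, E(j,k) = −E(k,j) if λ_j·λ_k > 0, and E(j,k) = E(k,j) if λ_j·λ_k < 0. Call two distinct indices a, b ∈ I compatible if E(a,k) = E(b,k) for every k ∈ I ∖ {a, b}. Fix j ∈ I and a function u : I ∖ {j} → ℝ such that for all distinct k, k′ ∈ I ∖ {j}, if u(k) ≤ u(k′) then E(k,k′) = E(j,k′). Assume that there is exactly one index j′ ∈ I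 ∖ {j} that is compatible with j. Then for every k ∈ I ∖ {j}, sign(λ_k)·E(j,k) = sign(λ_{j′})·E(j,j′). -/
/-- with `E` a sign table satisfying the antisymmetry relation
determined by nonzero reals `λ`, fix `j` and `u : I ∖ {j} → ℝ` such that
`u(k) ≤ u(k')` implies `E(k,k') = E(j,k')` for distinct `k, k' ≠ j`. If there
is exactly one index `j'` compatible with `j`, then for every `k ≠ j`,
`sign(λ_k)·E(j,k) = sign(λ_{j'})·E(j,j')`. -/
theorem stmt16 (I : Type*) [Fintype I] (lam : I → ℝ) (hlam : ∀ i, lam i ≠ 0)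
    (E : I → I → ℤ) (hE : ∀ j k, j ≠ k → E j k = 1 ∨ E j k = -1)
    (hanti : ∀ j k, j ≠ k →
      (0 < lam j * lam k → E j k = -E k j) ∧ (lam j * lam k < 0 → E j k = E k j))
    (j : I) (u : I → ℝ)
    (hu : ∀ k k', k ≠ j → k' ≠ j → k ≠ k' → u k ≤ u k' → E k k' = E j k')
    (huniq : ∃! j', j' ≠ j ∧ ∀ k, k ≠ j → k ≠ j' → E j k = E j' k) :
    ∀ j', j' ≠ j → (∀ k, k ≠ j → k ≠ j' → E j k = E j' k) →
      ∀ k, k ≠ j →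
        (if 0 < lam k then (1 : ℤ) else -1) * E j k
          = (if 0 < lam j' then (1 : ℤ) else -1) * E j j' := by
  intro j' hj' hcomp k hk
  by_contra hne
  -- A counterexample with `u` minimal is itself compatible with `j`, hence equal to `j'`.
  obtain ⟨m, ⟨hmj, hm⟩, hmin⟩ := Set.exists_min_image
    {k | k ≠ j ∧ (if 0 < lam k then (1 : ℤ) else -1) * E j k
      ≠ (if 0 < lam j' then (1 : ℤ) else -1) * E j j'} u (Set.toFinite _) ⟨k, hk, hne⟩
  have hmcomp : ∀ l, l ≠ j → l ≠ m → E j l = E m l := by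
    intro l hlj hlm
    rcases le_or_gt (u m) (u l) with hml | hlt
    · exact (hu m l hmj hlj hlm.symm hml).symm
    have hl : (if 0 < lam l then (1 : ℤ) else -1) * E j l
        = (if 0 < lam j' then (1 : ℤ) else -1) * E j j' := by
      by_contra h
      exact absurd (hmin l ⟨hlj, h⟩) (not_le.mpr hlt)
    rw [← hl] at hm
    have hlmE := hu l m hlj hmj hlm hlt.le
    obtain ⟨hpos, hneg⟩ := hanti m l hlm.symm
    have hEm := hE j m hmj.symm
    have hEl := hE j l hlj.symm
    rcases lt_or_gt_of_ne (hlam m) with h1 | h1 <;> rcases lt_or_gt_of_ne (hlam l) with h2 | h2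
    · have h := hpos (mul_pos_of_neg_of_neg h1 h2)
      rw [if_neg h1.not_gt, if_neg h2.not_gt] at hm
      omega
    · have h := hneg (mul_neg_of_neg_of_pos h1 h2)
      rw [if_neg h1.not_gt, if_pos h2] at hm
      omega
    · have h := hneg (mul_neg_of_pos_of_neg h1 h2)
      rw [if_pos h1, if_neg h2.not_gt] at hm
      omega
    · have h := hpos (mul_pos h1 h2)
      rw [if_pos h1, if_pos h2] at hm
      omega
  obtain rfl : m = j' := huniq.unique ⟨hmj, hmcomp⟩ ⟨hj', hcomp⟩
  exact hm rfl
end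

section
/- Let V be a real vector space and let I be a finite index set with at least two elements. Let a_k : V → ℝ be linear forms for k ∈ I, and let λ : I → ℝ satisfy λ_i ≠ 0 for all i, Σ_{k ∈ I} λ_k·a_k = 0 as a linear form on V, λ_{k₀} < 0 for some k₀ ∈ I and λ_{k₁} > 0 for some k₁ ∈ I. Let E assign to every ordered pair (j,k) of distinct elements of I a sign E(j,k) ∈ {−1, +1} satisfying: for all distinct j, k, E(j,k) = −E(k,j) if λ_j·λ_k > 0, and E(j,k) = E(k,j) if λ_j·λ_k < 0. For each j ∈ I define the cone C_j = {δ ∈ V : for every k ∈ I ∖ {j}, a_k(δ) > 0 if E(j,k) = +1, and a_k(δ) ≤ 0 if E(j,k) = −1}. Assume that for every j ∈ I there is a function u^{(j)} : I ∖ {j} → ℝ such that for all distinct k, k′ ∈ I ∖ {j}, u^{(j)}(k) ≤ u^{(j)}(k′) implies E(k,k′) = E(j,k′). Then for every j ∈ I, C_j ⊆ ∪_{k ∈ I ∖ {j}} C_k; consequently every δ ∈ V belongs to either zero or exactly two of the cones C_j, j ∈ I. -/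
/-- The sign of a real number, with the convention that `0` has sign `-1`. -/
noncomputable def strictSign (x : ℝ) : ℤ := if 0 < x then 1 else -1

lemma strictSign_eq_or (x : ℝ) : strictSign x = 1 ∨ strictSign x = -1 := by
  unfold strictSign
  split_ifs <;> simp

lemma mem_signCone_iff {I V : Type*} [AddCommGroup V] [Module ℝ V]
    {E : I → I → ℤ} (hE : ∀ j k, j ≠ k → E j k = 1 ∨ E j k = -1)
    (a : I → V →ₗ[ℝ] ℝ) (j : I) (δ : V) :
    δ ∈ signCone E a j ↔ ∀ k, k ≠ j → E j k = strictSign (a k δ) := by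
  simp only [signCone, Set.mem_ofPred_eq]
  refine forall₂_congr fun k hk => ?_
  unfold strictSign
  rcases hE j k hk.symm with h | h <;> split_ifs with h0 <;> simp [h, h0] <;> linarith

/-- The antisymmetry relation as a single product formula. -/
lemma eq_neg_strictSign_mul {I : Type*} {lam : I → ℝ} (hlam : ∀ i, lam i ≠ 0) {E : I → I → ℤ}
    (hanti : ∀ j k, j ≠ k →
      (0 < lam j * lam k → E j k = -E k j) ∧ (lam j * lam k < 0 → E j k = E k j))
    (j k : I) (hjk : j ≠ k) :
    E j k = -(strictSign (lam j) * strictSign (lam k) * E k j) := by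
  obtain ⟨hp, hn⟩ := hanti j k hjk
  rcases (hlam j).lt_or_gt with hj | hj <;> rcases (hlam k).lt_or_gt with hk | hk
  · simp [strictSign, hj.not_gt, hk.not_gt, hp (mul_pos_of_neg_of_neg hj hk)]
  · simp [strictSign, hj.not_gt, hk, hn (mul_neg_of_neg_of_pos hj hk)]
  · simp [strictSign, hj, hk.not_gt, hn (mul_neg_of_pos_of_neg hj hk)]
  · simp [strictSign, hj, hk, hp (mul_pos hj hk)]

/-- In a vanishing sum `∑ lam k * x k` with coefficients of both signs, the products of signs
`strictSign (lam k) * strictSign (x k)` are not all equal. -/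
lemma exists_strictSign_mul_eq_neg {I : Type*} [Fintype I] {lam x : I → ℝ}
    (hrel : ∑ k, lam k * x k = 0) (hneg : ∃ k, lam k < 0) (hpos : ∃ k, 0 < lam k) (j : I) :
    ∃ k, strictSign (lam k) * strictSign (x k) = -(strictSign (lam j) * strictSign (x j)) := by
  by_contra! h
  have hconst : ∀ k, strictSign (lam k) * strictSign (x k) =
      strictSign (lam j) * strictSign (x j) := fun k => by
    have := h k
    rcases strictSign_eq_or (lam k) with h1 | h1 <;> rcases strictSign_eq_or (x k) with h2 | h2 <;>
      rcases strictSign_eq_or (lam j) with h3 | h3 <;>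
      rcases strictSign_eq_or (x j) with h4 | h4 <;> simp_all
  have hval : strictSign (lam j) * strictSign (x j) = 1 ∨
      strictSign (lam j) * strictSign (x j) = -1 := by
    rcases strictSign_eq_or (lam j) with h3 | h3 <;>
      rcases strictSign_eq_or (x j) with h4 | h4 <;> simp [h3, h4]
  rcases hval with hval | hval
  · have hsign : ∀ k, 0 < lam k ↔ 0 < x k := fun k => by
      have := (hconst k).trans hval
      unfold strictSign at this
      split_ifs at this with h1 h2 h2 <;> first | omega | simp [h1, h2]
    obtain ⟨k, hk⟩ := hpos
    refine hrel.not_gt (Finset.sum_pos' (fun i _ => ?_) ⟨k, Finset.mem_univ k,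
      mul_pos hk ((hsign k).1 hk)⟩)
    by_cases hi : 0 < lam i
    · exact (mul_pos hi ((hsign i).1 hi)).le
    · exact mul_nonneg_of_nonpos_of_nonpos (not_lt.1 hi) (not_lt.1 fun h => hi ((hsign i).2 h))
  · have hsign : ∀ k, 0 < lam k ↔ ¬ 0 < x k := fun k => by
      have := (hconst k).trans hval
      unfold strictSign at this
      split_ifs at this with h1 h2 h2 <;> first | omega | simp [h1, h2]
    obtain ⟨k, hk⟩ := hneg
    have hx : ∀ i, ¬ 0 < lam i → 0 < x i := fun i hi => by
      by_contra h
      exact hi ((hsign i).2 h)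
    refine hrel.not_lt (Finset.sum_neg' (fun i _ => ?_) ⟨k, Finset.mem_univ k,
      mul_neg_of_neg_of_pos hk (hx k hk.not_gt)⟩)
    by_cases hi : 0 < lam i
    · exact mul_nonpos_of_nonneg_of_nonpos hi.le (not_lt.1 ((hsign i).1 hi))
    · exact mul_nonpos_of_nonpos_of_nonneg (not_lt.1 hi) (hx i hi).le

/-- If row `j` of the sign table agrees with `s` off the diagonal, then so does another row `k`,
namely the one minimizing `u` among those with `σ k * s k = -(σ j * s j)`. -/
lemma exists_ne_row_eq {I : Type*} [Finite I] {E : I → I → ℤ} {σ s : I → ℤ}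
    (hσ : ∀ i, σ i = 1 ∨ σ i = -1) (hs : ∀ i, s i = 1 ∨ s i = -1)
    (hanti : ∀ j k, j ≠ k → E j k = -(σ j * σ k * E k j)) {j : I} {u : I → ℝ}
    (hu : ∀ k k', k ≠ j → k' ≠ j → k ≠ k' → u k ≤ u k' → E k k' = E j k')
    (hex : ∃ k, σ k * s k = -(σ j * s j)) (hj : ∀ k, k ≠ j → E j k = s k) :
    ∃ k, k ≠ j ∧ ∀ k', k' ≠ k → E k k' = s k' := by
  obtain ⟨k, hk, hmin⟩ := Set.exists_min_image {k | σ k * s k = -(σ j * s j)} u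
    (Set.toFinite _) hex
  simp only [Set.mem_ofPred_eq] at hk hmin
  have hkj : k ≠ j := by
    rintro rfl
    rcases hσ k with h1 | h1 <;> rcases hs k with h2 | h2 <;> simp [h1, h2] at hk
  refine ⟨k, hkj, fun k' hk' => ?_⟩
  by_cases hk'j : k' = j
  · subst hk'j
    rw [hanti k k' hkj, hj k hkj]
    rcases hσ k with h1 | h1 <;> rcases hs k with h2 | h2 <;> rcases hσ k' with h3 | h3 <;>
      rcases hs k' with h4 | h4 <;> simp_all
  by_cases hle : u k ≤ u k'
  · rw [hu k k' hkj hk'j hk'.symm hle, hj k' hk'j]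
  · have hne : σ k' * s k' ≠ -(σ j * s j) := fun h => hle (hmin k' h)
    rw [hanti k k' hk'.symm, hu k' k hk'j hkj hk' (not_le.1 hle).le, hj k hkj]
    clear hu hmin hanti hj hle
    rcases hσ k with h1 | h1 <;> rcases hs k with h2 | h2 <;> rcases hσ k' with h3 | h3 <;>
      rcases hs k' with h4 | h4 <;> rcases hσ j with h5 | h5 <;>
      rcases hs j with h6 | h6 <;> simp_all

/-- Two distinct rows agreeing with `s` off the diagonal have opposite values of `σ * s`. -/
lemma mul_eq_neg_of_rows_eq {I : Type*} {E : I → I → ℤ} {σ s : I → ℤ}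
    (hσ : ∀ i, σ i = 1 ∨ σ i = -1) (hs : ∀ i, s i = 1 ∨ s i = -1)
    (hanti : ∀ j k, j ≠ k → E j k = -(σ j * σ k * E k j)) {j k : I} (hjk : j ≠ k)
    (hj : ∀ i, i ≠ j → E j i = s i) (hk : ∀ i, i ≠ k → E k i = s i) :
    σ j * s j = -(σ k * s k) := by
  have h := hanti j k hjk
  rw [hj k hjk.symm, hk j hjk] at h
  rcases hσ k with h1 | h1 <;> rcases hs k with h2 | h2 <;> rcases hσ j with h3 | h3 <;>
    rcases hs j with h4 | h4 <;> simp_all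

/-- under the linear relation `∑ λ_k a_k = 0` with mixed signs,
the antisymmetry relation for the sign table `E`, and the ordering hypothesis
(for every `j` there is `u^{(j)}` such that `u^{(j)}(k) ≤ u^{(j)}(k')` implies
`E(k,k') = E(j,k')`), every cone `C_j` is contained in the union of the other
cones; consequently every `δ ∈ V` belongs to either zero or exactly two of the
cones `C_j`. -/
theorem stmt17 (V : Type*) [AddCommGroup V] [Module ℝ V]
    (I : Type*) [Fintype I] (hI : 2 ≤ Fintype.card I)
    (a : I → V →ₗ[ℝ] ℝ) (lam : I → ℝ) (hlam : ∀ i, lam i ≠ 0)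
    (hrel : ∑ k, lam k • a k = 0)
    (hneg : ∃ k₀, lam k₀ < 0) (hpos : ∃ k₁, 0 < lam k₁)
    (E : I → I → ℤ) (hE : ∀ j k, j ≠ k → E j k = 1 ∨ E j k = -1)
    (hanti : ∀ j k, j ≠ k →
      (0 < lam j * lam k → E j k = -E k j) ∧ (lam j * lam k < 0 → E j k = E k j))
    (hu : ∀ j : I, ∃ u : I → ℝ,
      ∀ k k', k ≠ j → k' ≠ j → k ≠ k' → u k ≤ u k' → E k k' = E j k') :
    (∀ j : I, signCone E a j ⊆ ⋃ (k : I) (_ : k ≠ j), signCone E a k) ∧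
      ∀ δ : V,
        Nat.card {j : I // δ ∈ signCone E a j} = 0 ∨
          Nat.card {j : I // δ ∈ signCone E a j} = 2 := by
  have hE' := mem_signCone_iff hE a
  have hanti' := eq_neg_strictSign_mul hlam hanti
  have hσ := fun i => strictSign_eq_or (lam i)
  have hs := fun (δ : V) i => strictSign_eq_or (a i δ)
  have hcover : ∀ j δ, δ ∈ signCone E a j → ∃ k, k ≠ j ∧ δ ∈ signCone E a k := by
    intro j δ hδ
    simp only [hE'] at hδ ⊢
    obtain ⟨u, hu⟩ := hu j
    have hsum : ∑ k, lam k * a k δ = 0 := by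
      simpa using congrArg (fun f : V →ₗ[ℝ] ℝ => f δ) hrel
    exact exists_ne_row_eq hσ (hs δ) hanti' hu (exists_strictSign_mul_eq_neg hsum hneg hpos j) hδ
  refine ⟨fun j δ hδ => by simpa using hcover j δ hδ, fun δ => ?_⟩
  by_cases hne : ∃ j, δ ∈ signCone E a j
  · right
    obtain ⟨j, hj⟩ := hne
    obtain ⟨k, hkj, hk⟩ := hcover j δ hj
    rw [Nat.card_eq_two_iff]
    refine ⟨⟨j, hj⟩, ⟨k, hk⟩, by simpa using hkj.symm, Set.eq_univ_of_forall ?_⟩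
    rintro ⟨l, hl⟩
    simp only [Set.mem_insert_iff, Set.mem_singleton_iff, Subtype.mk.injEq]
    by_contra! hlne
    rw [hE'] at hj hk hl
    have hjk := mul_eq_neg_of_rows_eq hσ (hs δ) hanti' hkj hk hj
    have hlj := mul_eq_neg_of_rows_eq hσ (hs δ) hanti' hlne.1 hl hj
    have hlk := mul_eq_neg_of_rows_eq hσ (hs δ) hanti' hlne.2 hl hk
    have hl0 : strictSign (lam l) * strictSign (a l δ) = 0 := by omega
    rcases hσ l with h1 | h1 <;> rcases hs δ l with h2 | h2 <;> simp [h1, h2] at hl0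
  · left
    have : IsEmpty {j : I // δ ∈ signCone E a j} := ⟨fun j => hne ⟨j, j.2⟩⟩
    exact Nat.card_of_isEmpty
end
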